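/- For every n ≥ 1 there is a constant C = C(n) such that for every Korányi ball B ⊂ ℍⁿ and every C¹ function g on ℍⁿ, ∫_B ∫_B |g(x) − g(y)| dv(x) dv(y) ≤ C |B|^{(N+1)/N} ∫_{2B} |∇_b g| dv, where N = 2n+2 is the homogeneous dimension and 2B denotes the concentric Korányi ball of twice the radius. -/

import Mathlib

open MeasureTheory Real

noncomputable section

/-- The Heisenberg group `ℍⁿ` as `ℝ²ⁿ⁺¹`, with a point `(x, y, t)` standing for
`(z, t)` with `z = x + iy ∈ ℂⁿ`. -/
abbrev HeisN (n : ℕ) : Type := (Fin n → ℝ) × (Fin n → ℝ) × ℝ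

/-- Group law `(z,t)·(z',t') = (z+z', t+t'+2 Im⟨z,z'⟩)`, `⟨z,z'⟩ = Σ z_j conj z'_j`. -/
def HNmul {n : ℕ} (p q : HeisN n) : HeisN n :=
  (p.1 + q.1, p.2.1 + q.2.1,
    p.2.2 + q.2.2 + 2 * ∑ j, (p.2.1 j * q.1 j - p.1 j * q.2.1 j))

/-- Group inverse `(z,t)⁻¹ = (-z,-t)`. -/
def HNinv {n : ℕ} (p : HeisN n) : HeisN n := (-p.1, -p.2.1, -p.2.2)

/-- Korányi norm `ρ(z,t) = (|z|⁴ + t²)^(1/4)`. -/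
def rhoN {n : ℕ} (p : HeisN n) : ℝ :=
  ((∑ j, ((p.1 j) ^ 2 + (p.2.1 j) ^ 2)) ^ 2 + p.2.2 ^ 2) ^ ((1 : ℝ) / 4)

/-- Korányi ball `B(p,r) = {q : ρ(p⁻¹ q) < r}`. -/
def KballN {n : ℕ} (p : HeisN n) (r : ℝ) : Set (HeisN n) := {q | rhoN (HNmul (HNinv p) q) < r}

/-- Horizontal vector field `X_j = ∂_{x_j} + 2 y_j ∂_t` acting on a function. -/
def XdN {n : ℕ} (j : Fin n) (f : HeisN n → ℝ) (p : HeisN n) : ℝ :=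
  fderiv ℝ f p (Pi.single j 1, 0, 2 * p.2.1 j)

/-- Horizontal vector field `Y_j = ∂_{y_j} − 2 x_j ∂_t` acting on a function. -/
def YdN {n : ℕ} (j : Fin n) (f : HeisN n → ℝ) (p : HeisN n) : ℝ :=
  fderiv ℝ f p (0, Pi.single j 1, -(2 * p.1 j))

/-- Length of the horizontal gradient `∇_b f = (X₁f,…,Xₙf,Y₁f,…,Yₙf)`. -/
def gradbN {n : ℕ} (f : HeisN n → ℝ) (p : HeisN n) : ℝ :=
  Real.sqrt (∑ j, ((XdN j f p) ^ 2 + (YdN j f p) ^ 2))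

namespace HeisN

variable {n : ℕ}

/-- Parabolic dilation `(z,t) ↦ (rz, r²t)`. -/
def dil (r : ℝ) (p : HeisN n) : HeisN n := (r • p.1, r • p.2.1, r ^ 2 * p.2.2)

/-- The horizontal element `(a + ib, 0)`. -/
def hor (a b : Fin n → ℝ) : HeisN n := (a, b, 0)

/-- The left-invariant horizontal field `Σ a_j X_j + b_j Y_j` at `p`. -/
def horField (a b : Fin n → ℝ) (p : HeisN n) : HeisN n :=
  (a, b, 2 * ∑ j, (p.2.1 j * a j - p.1 j * b j))

lemma HNmul_assoc (p q s : HeisN n) : HNmul (HNmul p q) s = HNmul p (HNmul q s) := by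
  refine Prod.ext ?_ (Prod.ext ?_ ?_)
  · simp [HNmul, add_assoc]
  · simp [HNmul, add_assoc]
  · simp only [HNmul, Pi.add_apply]
    simp only [add_mul, mul_add, Finset.sum_sub_distrib, Finset.sum_add_distrib]
    ring

lemma HNmul_zero (p : HeisN n) : HNmul p 0 = p := by
  refine Prod.ext ?_ (Prod.ext ?_ ?_) <;> simp [HNmul]

lemma zero_HNmul (p : HeisN n) : HNmul 0 p = p := by
  refine Prod.ext ?_ (Prod.ext ?_ ?_) <;> simp [HNmul]

lemma HNinv_HNmul (p : HeisN n) : HNmul (HNinv p) p = 0 := by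
  refine Prod.ext ?_ (Prod.ext ?_ ?_)
  · simp [HNmul, HNinv]
  · simp [HNmul, HNinv]
  · simp [HNmul, HNinv, mul_comm]

lemma HNinv_HNmul_cancel_left (p q : HeisN n) : HNmul (HNinv p) (HNmul p q) = q := by
  rw [← HNmul_assoc, HNinv_HNmul, zero_HNmul]

lemma dil_mul (r : ℝ) (p q : HeisN n) : dil r (HNmul p q) = HNmul (dil r p) (dil r q) := by
  refine Prod.ext ?_ (Prod.ext ?_ ?_)
  · simp [HNmul, dil]
  · simp [HNmul, dil]
  · simp only [HNmul, dil, Pi.smul_apply, smul_eq_mul, mul_add, Finset.mul_sum]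
    congr 1
    refine Finset.sum_congr rfl fun j _ => ?_
    ring

lemma dil_hor (r : ℝ) (a b : Fin n → ℝ) : dil r (hor a b) = hor (r • a) (r • b) := by
  simp [dil, hor]

@[fun_prop]
lemma contDiff_mul {E : Type*} [NormedAddCommGroup E] [NormedSpace ℝ E] {k : WithTop ℕ∞}
    {f g : E → HeisN n} (hf : ContDiff ℝ k f) (hg : ContDiff ℝ k g) :
    ContDiff ℝ k fun x => HNmul (f x) (g x) := by
  unfold HNmul
  fun_prop

@[fun_prop]
lemma continuous_mul {E : Type*} [TopologicalSpace E]
    {f g : E → HeisN n} (hf : Continuous f) (hg : Continuous g) :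
    Continuous fun x => HNmul (f x) (g x) := by
  unfold HNmul
  fun_prop

@[fun_prop]
lemma continuous_inv {E : Type*} [TopologicalSpace E]
    {f : E → HeisN n} (hf : Continuous f) : Continuous fun x => HNinv (f x) := by
  unfold HNinv
  fun_prop

@[fun_prop]
lemma continuous_rho : Continuous (rhoN : HeisN n → ℝ) := by
  unfold rhoN
  exact Continuous.rpow_const (by fun_prop) fun _ => Or.inr (by norm_num)

@[fun_prop]
lemma contDiff_dil (r : ℝ) {k : WithTop ℕ∞} : ContDiff ℝ k (dil r : HeisN n → HeisN n) := by
  unfold dil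
  fun_prop

lemma measurePreserving_shear (a b : Fin n → ℝ) {l : (Fin n → ℝ) → (Fin n → ℝ) → ℝ}
    (hl : Continuous (Function.uncurry l)) :
    MeasurePreserving (fun p : HeisN n => (p.1 + a, p.2.1 + b, p.2.2 + l p.1 p.2.1))
      volume volume := by
  have hl' : ∀ x, Continuous (l x) := fun x => by
    exact hl.comp (by fun_prop : Continuous fun y => (x, y))
  have hm := hl.measurable
  refine MeasurePreserving.skew_product (μa := volume) (μb := volume) (μc := volume)
    (μd := volume) (f := fun x : Fin n → ℝ => x + a)
    (g := fun x (q : (Fin n → ℝ) × ℝ) => (q.1 + b, q.2 + l x q.1))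
    (measurePreserving_add_right volume a) ?_ (Filter.Eventually.of_forall fun x => ?_)
  · have : Continuous fun p : HeisN n => l p.1 p.2.1 :=
      hl.comp (by fun_prop : Continuous fun p : HeisN n => (p.1, p.2.1))
    exact Continuous.measurable (by unfold Function.uncurry; fun_prop)
  · refine (MeasurePreserving.skew_product (μa := volume) (μb := volume) (μc := volume)
      (μd := volume) (f := fun y : Fin n → ℝ => y + b)
      (g := fun y (t : ℝ) => t + l x y)
      (measurePreserving_add_right volume b) ?_ (Filter.Eventually.of_forall fun y => ?_)).map_eq
    · have := hl' x
      exact Continuous.measurable (by unfold Function.uncurry; fun_prop)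
    · exact (measurePreserving_add_right volume (l x y)).map_eq

lemma measurePreserving_mul_right (h : HeisN n) :
    MeasurePreserving (fun p => HNmul p h) volume volume := by
  have := measurePreserving_shear h.1 h.2.1
    (l := fun x y => h.2.2 + 2 * ∑ j, (y j * h.1 j - x j * h.2.1 j))
    (by unfold Function.uncurry; fun_prop)
  simpa only [HNmul, ← add_assoc] using this

lemma measurePreserving_mul_left (h : HeisN n) :
    MeasurePreserving (fun p => HNmul h p) volume volume := by
  have := measurePreserving_shear h.1 h.2.1
    (l := fun x y => h.2.2 + 2 * ∑ j, (h.2.1 j * x j - h.1 j * y j))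
    (by unfold Function.uncurry; fun_prop)
  convert this using 3 with p
  · exact add_comm _ _
  · refine Prod.ext (add_comm _ _) ?_
    simp only [HNmul]
    ring

lemma map_dil {r : ℝ} (hr : 0 < r) :
    Measure.map (dil r : HeisN n → HeisN n) volume
      = ENNReal.ofReal ((r ^ (2 * n + 2))⁻¹) • volume := by
  have e : (dil r : HeisN n → HeisN n) = Prod.map (r • ·) (Prod.map (r • ·) (r ^ 2 • ·)) := by
    ext p <;> simp [dil]
  have hf : Module.finrank ℝ (Fin n → ℝ) = n := by simp
  have h1 := Measure.map_addHaar_smul (volume : Measure (Fin n → ℝ)) hr.ne'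
  have h2 := Measure.map_addHaar_smul (volume : Measure ℝ) (pow_pos hr 2).ne'
  rw [e]
  have hv : (volume : Measure (HeisN n)) = (volume : Measure (Fin n → ℝ)).prod
    ((volume : Measure (Fin n → ℝ)).prod (volume : Measure ℝ)) := rfl
  rw [hv]
  have m1 : Measurable fun x : Fin n → ℝ => r • x := measurable_const_smul r
  have m2 : Measurable fun x : ℝ => r ^ 2 • x := measurable_const_smul (r ^ 2)
  rw [hf] at h1
  rw [Module.finrank_self] at h2
  rw [← Measure.map_prod_map _ _ m1 (m1.prodMap m2), ← Measure.map_prod_map _ _ m1 m2, h1, h2]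
  simp only [Measure.prod_smul_left, Measure.prod_smul_right, smul_smul]
  congr 1
  rw [← ENNReal.ofReal_mul (by positivity), ← ENNReal.ofReal_mul (by positivity),
    abs_of_pos (by positivity), abs_of_pos (by positivity)]
  congr 1
  field_simp
  ring

lemma fderiv_horField (g : HeisN n → ℝ) (a b : Fin n → ℝ) (p : HeisN n) :
    fderiv ℝ g p (horField a b p) = ∑ j, (a j * XdN j g p + b j * YdN j g p) := by
  have : horField a b p = ∑ j, (a j • ((Pi.single j 1, 0, 2 * p.2.1 j) : HeisN n)
      + b j • ((0, Pi.single j 1, -(2 * p.1 j)) : HeisN n)) := by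
    refine Prod.ext ?_ (Prod.ext ?_ ?_)
    · ext i
      simp [horField, Prod.fst_sum, Finset.sum_apply, Pi.single_apply]
    · ext i
      simp [horField, Prod.fst_sum, Prod.snd_sum, Finset.sum_apply, Pi.single_apply]
    · simp only [horField, Prod.snd_sum, Finset.mul_sum]
      refine Finset.sum_congr rfl fun j _ => ?_
      simp
      ring
  rw [this]
  simp only [map_sum, map_add, map_smul, smul_eq_mul, XdN, YdN]

lemma abs_fderiv_horField_le (g : HeisN n → ℝ) (a b : Fin n → ℝ) (p : HeisN n) :
    |fderiv ℝ g p (horField a b p)| ≤ (∑ j, (|a j| + |b j|)) * gradbN g p := by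
  have hle : ∀ j, (XdN j g p) ^ 2 + (YdN j g p) ^ 2
      ≤ ∑ j, ((XdN j g p) ^ 2 + (YdN j g p) ^ 2) := fun j =>
    Finset.single_le_sum (f := fun j => (XdN j g p) ^ 2 + (YdN j g p) ^ 2)
      (fun i _ => by positivity) (Finset.mem_univ j)
  have hX : ∀ j, |XdN j g p| ≤ gradbN g p := fun j =>
    Real.abs_le_sqrt (by have := hle j; nlinarith [sq_nonneg (YdN j g p)])
  have hY : ∀ j, |YdN j g p| ≤ gradbN g p := fun j =>
    Real.abs_le_sqrt (by have := hle j; nlinarith [sq_nonneg (XdN j g p)])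
  rw [fderiv_horField, Finset.sum_mul]
  refine (Finset.abs_sum_le_sum_abs _ _).trans (Finset.sum_le_sum fun j _ => ?_)
  refine (abs_add_le _ _).trans ?_
  rw [abs_mul, abs_mul, add_mul]
  exact add_le_add (mul_le_mul_of_nonneg_left (hX j) (abs_nonneg _))
    (mul_le_mul_of_nonneg_left (hY j) (abs_nonneg _))

lemma hasDerivAt_mul_hor {g : HeisN n → ℝ} (hg : ContDiff ℝ 1 g) (a b : Fin n → ℝ)
    (p : HeisN n) (s : ℝ) :
    HasDerivAt (fun s : ℝ => g (HNmul p (hor (s • a) (s • b))))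
      (fderiv ℝ g (HNmul p (hor (s • a) (s • b)))
        (horField a b (HNmul p (hor (s • a) (s • b))))) s := by
  have h1 : HasDerivAt (fun s : ℝ => HNmul p (hor (s • a) (s • b)))
      (horField a b (HNmul p (hor (s • a) (s • b)))) s := by
    refine HasDerivAt.prodMk ?_ (HasDerivAt.prodMk ?_ ?_)
    · simpa [hor, horField] using ((hasDerivAt_id s).smul_const a).const_add p.1
    · simpa [hor, horField] using ((hasDerivAt_id s).smul_const b).const_add p.2.1
    · have : HasDerivAt (fun s : ℝ => p.2.2 + s * (2 * ∑ j, (p.2.1 j * a j - p.1 j * b j)))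
          (1 * (2 * ∑ j, (p.2.1 j * a j - p.1 j * b j))) s :=
        ((hasDerivAt_id s).mul_const _).const_add _
      refine (this.congr_deriv ?_).congr_of_eventuallyEq (Filter.Eventually.of_forall fun s => ?_)
      · simp only [HNmul, hor, one_mul, Pi.add_apply, Pi.smul_apply, smul_eq_mul]
        congr 1
        refine Finset.sum_congr rfl fun j _ => ?_
        ring
      · simp only [hor, Pi.smul_apply, smul_eq_mul, Finset.mul_sum, add_zero]
        congr 1
        refine Finset.sum_congr rfl fun j _ => ?_
        ring
  exact ((hg.differentiable (by norm_num) _).hasFDerivAt).comp_hasDerivAt s h1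

lemma continuous_fderiv_horField {g : HeisN n → ℝ} (hg : ContDiff ℝ 1 g) (a b : Fin n → ℝ) :
    Continuous fun p => fderiv ℝ g p (horField a b p) := by
  have h1 : Continuous (fderiv ℝ g) := hg.continuous_fderiv (by norm_num)
  exact h1.clm_apply (by unfold horField; fun_prop)

lemma XdN_eq (g : HeisN n → ℝ) (j : Fin n) (p : HeisN n) :
    XdN j g p = fderiv ℝ g p (horField (Pi.single j 1) 0 p) := by
  simp [XdN, horField, Pi.single_apply]

lemma YdN_eq (g : HeisN n → ℝ) (j : Fin n) (p : HeisN n) :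
    YdN j g p = fderiv ℝ g p (horField 0 (Pi.single j 1) p) := by
  simp [YdN, horField, Pi.single_apply]

lemma continuous_gradb {g : HeisN n → ℝ} (hg : ContDiff ℝ 1 g) : Continuous (gradbN g) := by
  unfold gradbN
  simp only [XdN_eq, YdN_eq]
  have := continuous_fderiv_horField hg
  fun_prop

/-- The affine change of variables carrying the unit ball at `0` to `B(p,r)`. -/
def aff (p : HeisN n) (r : ℝ) (w : HeisN n) : HeisN n := HNmul p (dil r w)

lemma contDiff_aff (p : HeisN n) (r : ℝ) {k : WithTop ℕ∞} : ContDiff ℝ k (aff p r) := by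
  unfold aff
  fun_prop

@[fun_prop]
lemma continuous_aff (p : HeisN n) (r : ℝ) : Continuous (aff p r) :=
  (contDiff_aff p r (k := 0)).continuous

lemma fderiv_comp_aff {g : HeisN n → ℝ} (hg : ContDiff ℝ 1 g) (p : HeisN n) (r : ℝ)
    (a b : Fin n → ℝ) (w : HeisN n) :
    fderiv ℝ (g ∘ aff p r) w (horField a b w)
      = r * fderiv ℝ g (aff p r w) (horField a b (aff p r w)) := by
  have h1 := hasDerivAt_mul_hor (hg.comp (contDiff_aff p r)) a b w 0
  have h2 := hasDerivAt_mul_hor hg (r • a) (r • b) (aff p r w) 0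
  have z : (hor 0 0 : HeisN n) = 0 := rfl
  simp only [zero_smul, z, HNmul_zero] at h1 h2
  have e : horField (r • a) (r • b) (aff p r w) = r • horField a b (aff p r w) := by
    refine Prod.ext rfl (Prod.ext rfl ?_)
    simp only [horField, Pi.smul_apply, Prod.smul_snd, smul_eq_mul, Finset.mul_sum]
    refine Finset.sum_congr rfl fun j _ => ?_
    ring
  rw [e, map_smul, smul_eq_mul] at h2
  have e' : ∀ s : ℝ, (g ∘ aff p r) (HNmul w (hor (s • a) (s • b)))
      = g (HNmul (aff p r w) (hor (s • r • a) (s • r • b))) := fun s => by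
    simp only [aff, Function.comp_apply, dil_mul, dil_hor, HNmul_assoc, smul_comm r]
  simp only [e'] at h1
  exact h1.unique h2

lemma gradb_comp_aff {g : HeisN n → ℝ} (hg : ContDiff ℝ 1 g) (p : HeisN n) {r : ℝ} (hr : 0 < r)
    (w : HeisN n) : gradbN (g ∘ aff p r) w = r * gradbN g (aff p r w) := by
  unfold gradbN
  simp only [XdN_eq, YdN_eq, fderiv_comp_aff hg, mul_pow, ← mul_add, ← Finset.mul_sum]
  rw [Real.sqrt_mul (by positivity), Real.sqrt_sq hr.le]

lemma aff_preimage_ball (p : HeisN n) {r : ℝ} (hr : 0 < r) (s : ℝ) :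
    aff p r ⁻¹' KballN p (s * r) = KballN 0 s := by
  have hd : ∀ w : HeisN n, rhoN (dil r w) = r * rhoN w := by
    intro w
    have : (∑ j, ((dil r w).1 j ^ 2 + (dil r w).2.1 j ^ 2)) ^ 2 + (dil r w).2.2 ^ 2
        = r ^ 4 * ((∑ j, (w.1 j ^ 2 + w.2.1 j ^ 2)) ^ 2 + w.2.2 ^ 2) := by
      simp only [dil, Pi.smul_apply, smul_eq_mul, mul_pow, ← mul_add, ← Finset.mul_sum]
      ring
    rw [rhoN, this, Real.mul_rpow (by positivity) (by positivity), rhoN]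
    congr 1
    rw [← Real.rpow_natCast, ← Real.rpow_mul hr.le]
    norm_num
  ext w
  have z : (HNinv 0 : HeisN n) = 0 := by simp [HNinv]
  simp only [Set.mem_preimage, KballN, Set.mem_ofPred_eq, aff, HNinv_HNmul_cancel_left, hd, z,
    zero_HNmul]
  rw [mul_comm s r]
  exact mul_lt_mul_iff_right₀ hr

lemma map_aff (p : HeisN n) {r : ℝ} (hr : 0 < r) :
    Measure.map (aff p r) volume = ENNReal.ofReal ((r ^ (2 * n + 2))⁻¹) • volume := by
  have : aff p r = (fun q => HNmul p q) ∘ dil r := rfl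
  rw [this, ← Measure.map_map (measurePreserving_mul_left p).measurable
    (contDiff_dil r (k := 0)).continuous.measurable, map_dil hr, Measure.map_smul,
    (measurePreserving_mul_left p).map_eq]

lemma isOpen_ball (p : HeisN n) (r : ℝ) : IsOpen (KballN p r) := by
  unfold KballN
  exact isOpen_lt (by fun_prop) continuous_const

lemma setLIntegral_ball (p : HeisN n) {r : ℝ} (hr : 0 < r) (s : ℝ) {F : HeisN n → ENNReal}
    (hF : Measurable F) :
    ∫⁻ x in KballN p (s * r), F x
      = ENNReal.ofReal (r ^ (2 * n + 2)) * ∫⁻ w in KballN 0 s, F (aff p r w) := by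
  have := setLIntegral_map (μ := volume) (isOpen_ball p (s * r)).measurableSet hF
    (continuous_aff p r).measurable
  rw [map_aff p hr, Measure.restrict_smul, lintegral_smul_measure, aff_preimage_ball p hr] at this
  rw [← this, smul_eq_mul, ← mul_assoc, ← ENNReal.ofReal_mul (by positivity),
    mul_inv_cancel₀ (by positivity), ENNReal.ofReal_one, one_mul]

/-- The integral of `|∇_b g|` over the ball of radius `2` at `0`. -/
def gradInt (g : HeisN n → ℝ) : ENNReal :=
  ∫⁻ x in KballN 0 2, ENNReal.ofReal (gradbN g x)

lemma setLIntegral_mul_right_le {V W : Set (HeisN n)} (hW : MeasurableSet W) (k : HeisN n)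
    (hVW : ∀ x ∈ V, HNmul x k ∈ W) {F : HeisN n → ENNReal} (hF : Measurable F) :
    ∫⁻ x in V, F (HNmul x k) ≤ ∫⁻ x in W, F x := by
  rw [← (measurePreserving_mul_right k).setLIntegral_comp_preimage hW hF]
  exact lintegral_mono_set hVW

lemma lintegral_diff_hor_le {g : HeisN n → ℝ} (hg : ContDiff ℝ 1 g) {a b : Fin n → ℝ}
    (hab : ∑ j, (|a j| + |b j|) ≤ 1) {V : Set (HeisN n)}
    (hV : ∀ s ∈ Set.Icc (0 : ℝ) 1, ∀ x ∈ V, HNmul x (hor (s • a) (s • b)) ∈ KballN 0 2) :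
    ∫⁻ x in V, ‖g (HNmul x (hor a b)) - g x‖ₑ ≤ gradInt g := by
  have hG := continuous_gradb hg
  have hpt : ∀ x, ‖g (HNmul x (hor a b)) - g x‖ₑ ≤ ∫⁻ s in Set.Ioc (0 : ℝ) 1,
      ENNReal.ofReal (gradbN g (HNmul x (hor (s • a) (s • b)))) := by
    intro x
    have hc : Continuous fun s : ℝ => fderiv ℝ g (HNmul x (hor (s • a) (s • b)))
        (horField a b (HNmul x (hor (s • a) (s • b)))) :=
      (continuous_fderiv_horField hg a b).comp (by unfold hor; fun_prop)
    have h := intervalIntegral.integral_eq_sub_of_hasDerivAt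
      (fun s _ => hasDerivAt_mul_hor hg a b x s) (hc.intervalIntegrable 0 1)
    have z : (hor 0 0 : HeisN n) = 0 := rfl
    simp only [one_smul, zero_smul, z, HNmul_zero] at h
    rw [← h, intervalIntegral.integral_of_le zero_le_one]
    refine (enorm_integral_le_lintegral_enorm _).trans (lintegral_mono fun s => ?_)
    rw [Real.enorm_eq_ofReal_abs]
    refine ENNReal.ofReal_le_ofReal ((abs_fderiv_horField_le _ _ _ _).trans ?_)
    exact mul_le_of_le_one_left (Real.sqrt_nonneg _) hab
  refine (lintegral_mono hpt).trans ?_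
  rw [lintegral_lintegral_swap]
  · calc _ ≤ ∫⁻ _ in Set.Ioc (0 : ℝ) 1, gradInt g := by
          refine setLIntegral_mono' measurableSet_Ioc fun s hs => ?_
          exact setLIntegral_mul_right_le (isOpen_ball 0 2).measurableSet _
            (hV s (Set.Ioc_subset_Icc_self hs)) hG.measurable.ennreal_ofReal
      _ = gradInt g := by simp
  · refine Measurable.aemeasurable (Measurable.ennreal_ofReal ?_)
    exact (hG.comp (by unfold hor; fun_prop : Continuous fun q : HeisN n × ℝ =>
      HNmul q.1 (hor (q.2 • a) (q.2 • b)))).measurable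

open Filter Topology

/-- A family of group elements shrinking to `0` along `l` such that right translations by its
members are controlled in `L¹`, locally in the ball of radius `2`, by the horizontal gradient. -/
def Controlled {ι : Type*} (l : Filter ι) (f : ι → HeisN n) : Prop :=
  Tendsto f l (𝓝 0) ∧ ∀ a ∈ KballN (0 : HeisN n) 2, ∃ M : ENNReal, M ≠ ⊤ ∧ ∃ V, IsOpen V ∧ a ∈ V ∧
    ∀ᶠ h in l, ∀ g : HeisN n → ℝ, ContDiff ℝ 1 g →
      ∫⁻ x in V, ‖g (HNmul x (f h)) - g x‖ₑ ≤ M * gradInt g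

lemma exists_nhds_mul_mem {a : HeisN n} {U : Set (HeisN n)} (hU : IsOpen U) (ha : a ∈ U) :
    ∃ V, IsOpen V ∧ a ∈ V ∧ ∃ ε > 0, ∀ x ∈ V, ∀ k : HeisN n, ‖k‖ < ε → HNmul x k ∈ U := by
  have hc : Continuous fun q : HeisN n × HeisN n => HNmul q.1 q.2 := by fun_prop
  have : (fun q : HeisN n × HeisN n => HNmul q.1 q.2) ⁻¹' U ∈ 𝓝 (a, (0 : HeisN n)) :=
    (hU.preimage hc).mem_nhds (by simpa [HNmul_zero] using ha)
  obtain ⟨V, hV, W, hW, hVW⟩ := mem_nhds_prod_iff.1 this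
  obtain ⟨V', hV', hVo, haV⟩ := mem_nhds_iff.1 hV
  obtain ⟨ε, hε, hεW⟩ := Metric.mem_nhds_iff.1 hW
  exact ⟨V', hVo, haV, ε, hε, fun x hx k hk =>
    hVW (Set.mk_mem_prod (hV' hx) (hεW (by simpa using hk)))⟩

lemma Controlled.mul {ι : Type*} {l : Filter ι} {f₁ f₂ : ι → HeisN n} (h₁ : Controlled l f₁)
    (h₂ : Controlled l f₂) : Controlled l fun i => HNmul (f₁ i) (f₂ i) := by
  refine ⟨?_, fun a ha => ?_⟩
  · have hc : Continuous fun q : HeisN n × HeisN n => HNmul q.1 q.2 := by fun_prop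
    have := (hc.tendsto (0, 0)).comp (h₁.1.prodMk_nhds h₂.1)
    simpa [Function.comp_def, HNmul_zero] using this
  obtain ⟨M₁, hM₁, V₁, hV₁, ha₁, H₁⟩ := h₁.2 a ha
  obtain ⟨M₂, hM₂, V₂, hV₂, ha₂, H₂⟩ := h₂.2 a ha
  obtain ⟨V, hV, haV, ε, hε, hVk⟩ := exists_nhds_mul_mem hV₂ ha₂
  refine ⟨M₁ + M₂, by finiteness, V₁ ∩ V, hV₁.inter hV, ⟨ha₁, haV⟩, ?_⟩
  have hsmall : ∀ᶠ i in l, ‖f₁ i‖ < ε := by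
    have := h₁.1.norm
    rw [norm_zero] at this
    exact this.eventually_lt_const hε
  filter_upwards [H₁, H₂, hsmall] with i H₁ H₂ hi g hg
  have hgc := hg.continuous
  have hF : Continuous fun y => ‖g (HNmul y (f₂ i)) - g y‖ₑ := by fun_prop
  have hF₁ : Continuous fun y => ‖g (HNmul y (f₁ i)) - g y‖ₑ := by fun_prop
  calc ∫⁻ x in V₁ ∩ V, ‖g (HNmul x (HNmul (f₁ i) (f₂ i))) - g x‖ₑ
      ≤ ∫⁻ x in V₁ ∩ V, (‖g (HNmul x (f₁ i)) - g x‖ₑ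
          + ‖g (HNmul (HNmul x (f₁ i)) (f₂ i)) - g (HNmul x (f₁ i))‖ₑ) := by
        refine lintegral_mono fun x => ?_
        rw [HNmul_assoc, add_comm]
        refine le_trans (le_of_eq ?_) (enorm_add_le _ _)
        rw [sub_add_sub_cancel]
    _ = (∫⁻ x in V₁ ∩ V, ‖g (HNmul x (f₁ i)) - g x‖ₑ)
          + ∫⁻ x in V₁ ∩ V, ‖g (HNmul (HNmul x (f₁ i)) (f₂ i)) - g (HNmul x (f₁ i))‖ₑ :=
        lintegral_add_left hF₁.measurable _
    _ ≤ M₁ * gradInt g + M₂ * gradInt g := by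
        refine add_le_add ((lintegral_mono_set Set.inter_subset_left).trans (H₁ g hg)) ?_
        exact (setLIntegral_mul_right_le hV₂.measurableSet (f₁ i)
          (fun x hx => hVk x hx.2 _ hi) hF.measurable).trans (H₂ g hg)
    _ = (M₁ + M₂) * gradInt g := (add_mul _ _ _).symm

lemma controlled_hor {ι : Type*} {l : Filter ι} {α β : ι → Fin n → ℝ} (hα : Tendsto α l (𝓝 0))
    (hβ : Tendsto β l (𝓝 0)) : Controlled l fun i => hor (α i) (β i) := by
  have ht : Tendsto (fun i => hor (α i) (β i)) l (𝓝 (0 : HeisN n)) :=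
    hα.prodMk_nhds (hβ.prodMk_nhds tendsto_const_nhds)
  refine ⟨ht, fun a ha => ?_⟩
  obtain ⟨V, hV, haV, ε, hε, hVk⟩ := exists_nhds_mul_mem (isOpen_ball 0 2) ha
  refine ⟨1, by simp, V, hV, haV, ?_⟩
  have hsmall : ∀ᶠ i in l, ‖(hor (α i) (β i) : HeisN n)‖ < ε := by
    have := ht.norm
    rw [norm_zero] at this
    exact this.eventually_lt_const hε
  have hsum : ∀ᶠ i in l, ∑ j, (|α i j| + |β i j|) < 1 := by
    have hc : Continuous fun q : (Fin n → ℝ) × (Fin n → ℝ) => ∑ j, (|q.1 j| + |q.2 j|) := by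
      fun_prop
    have := (hc.tendsto (0, 0)).comp (hα.prodMk_nhds hβ)
    simp only [Pi.zero_apply, abs_zero, add_zero, Finset.sum_const_zero] at this
    exact this.eventually_lt_const one_pos
  filter_upwards [hsmall, hsum] with i hi hs g hg
  rw [one_mul]
  refine lintegral_diff_hor_le hg hs.le fun s hs x hx => hVk x hx _ (lt_of_le_of_lt ?_ hi)
  have : (hor (s • α i) (s • β i) : HeisN n) = s • hor (α i) (β i) := by simp [hor]
  rw [this, norm_smul, Real.norm_of_nonneg hs.1]
  exact mul_le_of_le_one_left (norm_nonneg _) hs.2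

lemma controlled_id (hn : 1 ≤ n) : Controlled (𝓝 (0 : HeisN n)) fun h => h := by
  set j₀ : Fin n := ⟨0, hn⟩
  set u : HeisN n → Fin n → ℝ := fun h => Real.sqrt |h.2.2| • Pi.single j₀ (1 / 2)
  set v : HeisN n → Fin n → ℝ := fun h =>
    (SignType.sign h.2.2 : ℝ) • Real.sqrt |h.2.2| • Pi.single j₀ (1 / 2)
  have hu : Tendsto u (𝓝 0) (𝓝 0) := by
    have : Continuous u := by fun_prop
    simpa [u] using this.tendsto 0
  have hv : Tendsto v (𝓝 0) (𝓝 0) := by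
    refine squeeze_zero_norm (a := fun h => ‖u h‖) (fun h => ?_) (by simpa using hu.norm)
    rw [norm_smul]
    refine mul_le_of_le_one_left (norm_nonneg _) ?_
    rcases lt_trichotomy h.2.2 0 with h | h | h <;> simp [h]
  have hu' : Tendsto (fun h => -u h) (𝓝 0) (𝓝 0) := by simpa using hu.neg
  have hv' : Tendsto (fun h => -v h) (𝓝 0) (𝓝 0) := by simpa using hv.neg
  have z : Tendsto (fun _ : HeisN n => (0 : Fin n → ℝ)) (𝓝 0) (𝓝 0) := tendsto_const_nhds
  have h₁ : Tendsto (fun h : HeisN n => h.1) (𝓝 0) (𝓝 0) := continuous_fst.tendsto 0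
  have h₂ : Tendsto (fun h : HeisN n => h.2.1) (𝓝 0) (𝓝 0) :=
    (continuous_fst.comp continuous_snd).tendsto 0
  have := (controlled_hor h₁ h₂).mul ((((controlled_hor z hv).mul (controlled_hor hu z)).mul
    (controlled_hor z hv')).mul (controlled_hor hu' z))
  convert this using 2 with h
  have hs : (SignType.sign h.2.2 : ℝ) * (Real.sqrt |h.2.2| * Real.sqrt |h.2.2|) = h.2.2 := by
    rw [Real.mul_self_sqrt (abs_nonneg _), sign_mul_abs]
  refine Prod.ext ?_ (Prod.ext ?_ ?_)
  · simp [HNmul, hor]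
  · simp [HNmul, hor]
  · have h1 : ∑ j, u h j * v h j = h.2.2 / 4 := by
      simp only [u, v, Pi.smul_apply, smul_eq_mul]
      rw [Finset.sum_eq_single j₀ (fun j _ hj => by simp [hj]) (by simp)]
      simp only [Pi.single_eq_same]
      linear_combination hs / 4
    have h2 : ∑ j, v h j * u h j = h.2.2 / 4 := by
      rw [← h1]
      exact Finset.sum_congr rfl fun j _ => mul_comm _ _
    simp [HNmul, hor, h1, h2]
    linarith

/-- The double integral `∫_S ∫_T |g(x) - g(y)|`. -/
def osc (g : HeisN n → ℝ) (S T : Set (HeisN n)) : ENNReal :=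
  ∫⁻ x in S, ∫⁻ y in T, ‖g x - g y‖ₑ

/-- `U` is open of finite measure and the oscillation of `C¹` functions over `U × U` is
controlled by the horizontal gradient on the ball of radius `2`. -/
def PoincareSet (U : Set (HeisN n)) : Prop :=
  IsOpen U ∧ volume U ≠ ⊤ ∧ ∃ M : ENNReal, M ≠ ⊤ ∧ ∀ g : HeisN n → ℝ, ContDiff ℝ 1 g →
    osc g U U ≤ M * gradInt g

lemma osc_comm {g : HeisN n → ℝ} (hg : Continuous g) (S T : Set (HeisN n)) :
    osc g S T = osc g T S := by
  unfold osc
  rw [lintegral_lintegral_swap]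
  · simp only [enorm_sub_rev]
  · exact Continuous.aemeasurable (by unfold Function.uncurry; fun_prop)

lemma osc_mono {g : HeisN n → ℝ} {S S' T T' : Set (HeisN n)} (hS : S ⊆ S') (hT : T ⊆ T') :
    osc g S T ≤ osc g S' T' :=
  (lintegral_mono_set hS).trans (lintegral_mono fun _ => lintegral_mono_set hT)

lemma osc_union_le {g : HeisN n → ℝ} (hg : Continuous g) (S T : Set (HeisN n)) :
    osc g (S ∪ T) (S ∪ T) ≤ osc g S S + osc g T T + 2 * osc g S T := by
  have h : ∀ A, osc g A (S ∪ T) ≤ osc g A S + osc g A T := fun A => by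
    have hm : Measurable fun x => ∫⁻ y in S, ‖g x - g y‖ₑ :=
      Measurable.lintegral_prod_right' (f := fun q : HeisN n × HeisN n => ‖g q.1 - g q.2‖ₑ)
        (Continuous.measurable (by fun_prop))
    unfold osc
    rw [← lintegral_add_left hm]
    exact lintegral_mono fun x => lintegral_union_le _ _ _
  calc osc g (S ∪ T) (S ∪ T) ≤ osc g S (S ∪ T) + osc g T (S ∪ T) := lintegral_union_le _ _ _
    _ ≤ (osc g S S + osc g S T) + (osc g T S + osc g T T) := add_le_add (h S) (h T)
    _ = _ := by rw [osc_comm hg T S]; ring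

lemma measure_mul_osc_le {g : HeisN n → ℝ} (hg : Continuous g) (S T I : Set (HeisN n)) :
    volume I * osc g S T ≤ volume T * osc g S I + volume S * osc g I T := by
  have m1 : ∀ A : Set (HeisN n), Measurable fun x => ∫⁻ y in A, ‖g x - g y‖ₑ := fun A =>
    Measurable.lintegral_prod_right' (f := fun q : HeisN n × HeisN n => ‖g q.1 - g q.2‖ₑ)
      (Continuous.measurable (by fun_prop))
  have hin : ∀ x y, volume I * ‖g x - g y‖ₑ
      ≤ (∫⁻ z in I, ‖g x - g z‖ₑ) + ∫⁻ z in I, ‖g z - g y‖ₑ := fun x y => by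
    rw [← lintegral_add_left (Continuous.measurable (by fun_prop)), mul_comm,
      ← setLIntegral_const]
    refine lintegral_mono fun z => le_trans (le_of_eq ?_) (enorm_add_le _ _)
    rw [sub_add_sub_cancel]
  calc volume I * osc g S T = ∫⁻ x in S, ∫⁻ y in T, volume I * ‖g x - g y‖ₑ := by
        unfold osc
        rw [← lintegral_const_mul _ (m1 T)]
        refine lintegral_congr fun x => ?_
        rw [lintegral_const_mul _ (Continuous.measurable (by fun_prop))]
    _ ≤ ∫⁻ x in S, ∫⁻ y in T, ((∫⁻ z in I, ‖g x - g z‖ₑ) + ∫⁻ z in I, ‖g z - g y‖ₑ) :=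
        lintegral_mono fun x => lintegral_mono fun y => hin x y
    _ = ∫⁻ x in S, ((volume T * ∫⁻ z in I, ‖g x - g z‖ₑ) + osc g T I) := by
        refine lintegral_congr fun x => ?_
        rw [lintegral_add_left measurable_const, setLIntegral_const, mul_comm]
        simp only [osc, enorm_sub_rev]
    _ = _ := by
        rw [lintegral_add_left ((m1 I).const_mul _), lintegral_const_mul _ (m1 I),
          setLIntegral_const, mul_comm _ (volume S), osc_comm hg T I]
        rfl

lemma PoincareSet.union {S T : Set (HeisN n)} (hS : PoincareSet S) (hT : PoincareSet T)
    (hST : (S ∩ T).Nonempty) : PoincareSet (S ∪ T) := by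
  obtain ⟨oS, vS, M, hM, HS⟩ := hS
  obtain ⟨oT, vT, M', hM', HT⟩ := hT
  have h0 : volume (S ∩ T) ≠ 0 := ((oS.inter oT).measure_pos volume hST).ne'
  have hfin : volume (S ∩ T) ≠ ⊤ := measure_ne_top_of_subset Set.inter_subset_left vS
  refine ⟨oS.union oT, by finiteness, M + M' + 2 * ((volume (S ∩ T))⁻¹ *
    (volume T * M + volume S * M')), by finiteness, fun g hg => ?_⟩
  have hI : osc g S T ≤ (volume (S ∩ T))⁻¹ * (volume T * M + volume S * M') * gradInt g := by
    rw [mul_assoc, ← ENNReal.mul_le_iff_le_inv h0 hfin]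
    refine (measure_mul_osc_le hg.continuous S T (S ∩ T)).trans ?_
    rw [add_mul, mul_assoc, mul_assoc]
    exact add_le_add
      (mul_le_mul_right ((osc_mono subset_rfl Set.inter_subset_left).trans (HS g hg)) _)
      (mul_le_mul_right ((osc_mono Set.inter_subset_right subset_rfl).trans (HT g hg)) _)
  refine (osc_union_le hg.continuous S T).trans ?_
  rw [add_mul, add_mul, mul_assoc 2]
  exact add_le_add (add_le_add (HS g hg) (HT g hg)) (mul_le_mul_right hI _)

lemma exists_poincareSet (hn : 1 ≤ n) {a : HeisN n} (ha : a ∈ KballN (0 : HeisN n) 2) :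
    ∃ U, a ∈ U ∧ PoincareSet U := by
  obtain ⟨M, hM, V, hV, haV, H⟩ := (controlled_id hn).2 a ha
  obtain ⟨ε, hε, hεH⟩ := Metric.eventually_nhds_iff_ball.1 H
  have hc : Continuous fun q : HeisN n × HeisN n => HNmul (HNinv q.1) q.2 := by fun_prop
  have hmem : (fun q : HeisN n × HeisN n => HNmul (HNinv q.1) q.2) ⁻¹' Metric.ball 0 ε
      ∈ 𝓝 (a, a) :=
    (Metric.isOpen_ball.preimage hc).mem_nhds (by simpa [HNinv_HNmul] using hε)
  obtain ⟨A, hA, B, hB, hAB⟩ := mem_nhds_prod_iff.1 hmem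
  obtain ⟨U, hU, hUo, haU⟩ := mem_nhds_iff.1
    (Filter.inter_mem (Filter.inter_mem hA hB)
      (Filter.inter_mem (hV.mem_nhds haV) (Metric.ball_mem_nhds a one_pos)))
  have hW : volume (Metric.ball (0 : HeisN n) ε) ≠ ⊤ := measure_ball_lt_top.ne
  refine ⟨U, haU, hUo, ?_, M * volume (Metric.ball (0 : HeisN n) ε), by finiteness,
    fun g hg => ?_⟩
  · exact measure_ne_top_of_subset (fun x hx => (hU hx).2.2)
      (measure_ball_lt_top (μ := volume) (x := a) (r := 1)).ne
  have hgc := hg.continuous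
  calc osc g U U
      ≤ ∫⁻ x in U, ∫⁻ h in Metric.ball (0 : HeisN n) ε, ‖g (HNmul x h) - g x‖ₑ := by
        refine setLIntegral_mono' hUo.measurableSet fun x hx => ?_
        simp only [enorm_sub_rev (g x)]
        rw [← (measurePreserving_mul_left x).setLIntegral_comp_preimage hUo.measurableSet
          (f := fun y => ‖g y - g x‖ₑ) (Continuous.measurable (by fun_prop))]
        refine lintegral_mono_set fun h hh => ?_
        have := hAB (Set.mk_mem_prod (hU hx).1.1 (hU hh).1.2)
        simpa only [Set.mem_preimage, HNinv_HNmul_cancel_left] using this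
    _ = ∫⁻ h in Metric.ball (0 : HeisN n) ε, ∫⁻ x in U, ‖g (HNmul x h) - g x‖ₑ := by
        rw [lintegral_lintegral_swap]
        exact Continuous.aemeasurable (by unfold Function.uncurry; fun_prop)
    _ ≤ ∫⁻ _ in Metric.ball (0 : HeisN n) ε, M * gradInt g := by
        refine setLIntegral_mono' Metric.isOpen_ball.measurableSet fun h hh => ?_
        exact (lintegral_mono_set fun x hx => (hU hx).2.1).trans (hεH h hh g hg)
    _ = M * volume (Metric.ball (0 : HeisN n) ε) * gradInt g := by
        rw [setLIntegral_const]
        ring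

lemma mem_ball_zero {x : HeisN n} {r : ℝ} : x ∈ KballN 0 r ↔ rhoN x < r := by
  have z : (HNinv 0 : HeisN n) = 0 := by simp [HNinv]
  simp [KballN, z, zero_HNmul]

lemma rho_zero : rhoN (0 : HeisN n) = 0 := by simp [rhoN]

lemma rho_smul_le {s : ℝ} (hs : s ∈ Set.Icc (0 : ℝ) 1) (x : HeisN n) : rhoN (s • x) ≤ rhoN x := by
  refine Real.rpow_le_rpow (by positivity) ?_ (by norm_num)
  have h : ∀ u : ℝ, (s * u) ^ 2 ≤ u ^ 2 := fun u => by
    rw [mul_pow]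
    exact mul_le_of_le_one_left (sq_nonneg u) (pow_le_one₀ hs.1 hs.2)
  refine add_le_add (pow_le_pow_left₀ (by positivity) (Finset.sum_le_sum fun j _ => ?_) 2) (h _)
  exact add_le_add (h _) (h _)

lemma isPreconnected_ball_zero {r : ℝ} (hr : 0 < r) :
    IsPreconnected (KballN (0 : HeisN n) r) := by
  have h0 : (0 : HeisN n) ∈ KballN (0 : HeisN n) r := by rwa [mem_ball_zero, rho_zero]
  have : StarConvex ℝ (0 : HeisN n) (KballN 0 r) := by
    rw [starConvex_zero_iff]
    intro x hx s h0 h1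
    rw [mem_ball_zero] at hx ⊢
    exact (rho_smul_le ⟨h0, h1⟩ x).trans_lt hx
  exact (this.isPathConnected h0).isConnected.isPreconnected

lemma isCompact_rho_le_one : IsCompact {x : HeisN n | rhoN x ≤ 1} := by
  refine (isCompact_closedBall (0 : HeisN n) 1).of_isClosed_subset
    (isClosed_le continuous_rho continuous_const) fun x (hx : rhoN x ≤ 1) => ?_
  have hq : 0 ≤ (∑ j, ((x.1 j) ^ 2 + (x.2.1 j) ^ 2)) := by positivity
  have h : (∑ j, ((x.1 j) ^ 2 + (x.2.1 j) ^ 2)) ^ 2 + x.2.2 ^ 2 ≤ 1 := by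
    by_contra! hlt
    exact absurd hx (not_le.2 (Real.one_lt_rpow hlt (by norm_num)))
  have hz : ∑ j, ((x.1 j) ^ 2 + (x.2.1 j) ^ 2) ≤ 1 := by
    nlinarith [sq_nonneg x.2.2]
  have hj : ∀ j, (x.1 j) ^ 2 + (x.2.1 j) ^ 2 ≤ 1 := fun j =>
    (Finset.single_le_sum (f := fun j => (x.1 j) ^ 2 + (x.2.1 j) ^ 2)
      (fun i _ => by positivity) (Finset.mem_univ j)).trans hz
  have habs : ∀ u : ℝ, u ^ 2 ≤ 1 → ‖u‖ ≤ 1 := fun u hu => (sq_le_one_iff_abs_le_one u).1 hu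
  rw [mem_closedBall_zero_iff, Prod.norm_def, Prod.norm_def]
  refine max_le ((pi_norm_le_iff_of_nonneg zero_le_one).2 fun j => habs _ ?_)
    (max_le ((pi_norm_le_iff_of_nonneg zero_le_one).2 fun j => habs _ ?_) (habs _ ?_))
  · nlinarith [hj j, sq_nonneg (x.2.1 j)]
  · nlinarith [hj j, sq_nonneg (x.1 j)]
  · nlinarith [sq_nonneg (∑ j, ((x.1 j) ^ 2 + (x.2.1 j) ^ 2))]

lemma exists_poincareSet_zero_mem (hn : 1 ≤ n) {a : HeisN n} (ha : a ∈ KballN (0 : HeisN n) 2) :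
    ∃ U, 0 ∈ U ∧ a ∈ U ∧ PoincareSet U := by
  set A : Set (HeisN n) := {a | ∃ U, 0 ∈ U ∧ a ∈ U ∧ PoincareSet U} with hA
  have hAo : IsOpen A := isOpen_iff_mem_nhds.2 fun x ⟨U, h0, hx, hU⟩ =>
    Filter.mem_of_superset (hU.1.mem_nhds hx) fun y hy => ⟨U, h0, hy, hU⟩
  have h0 : (0 : HeisN n) ∈ KballN (0 : HeisN n) 2 := by
    rw [mem_ball_zero, rho_zero]
    norm_num
  have h0A : (0 : HeisN n) ∈ A := by
    obtain ⟨U, h, hU⟩ := exists_poincareSet hn h0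
    exact ⟨U, h, h, hU⟩
  refine (isPreconnected_ball_zero two_pos).subset_of_closure_inter_subset hAo ⟨0, h0, h0A⟩
    (fun x ⟨hx, hx2⟩ => ?_) ha
  obtain ⟨V, hxV, hV⟩ := exists_poincareSet hn hx2
  obtain ⟨y, hyV, U, h0U, hyU, hU⟩ := mem_closure_iff.1 hx V hV.1 hxV
  exact ⟨U ∪ V, Or.inl h0U, Or.inr hxV, hU.union hV ⟨y, hyU, hyV⟩⟩

lemma exists_poincareSet_unit_ball (hn : 1 ≤ n) :
    ∃ U : Set (HeisN n), KballN 0 1 ⊆ U ∧ PoincareSet U := by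
  have h1 : (0 : HeisN n) ∈ KballN (0 : HeisN n) 2 := by
    rw [mem_ball_zero, rho_zero]
    norm_num
  obtain ⟨U, -, hU, hP⟩ : ∃ U : Set (HeisN n), 0 ∈ U ∧ {x | rhoN x ≤ 1} ⊆ U ∧ PoincareSet U := by
    refine isCompact_rho_le_one.induction_on
      (p := fun S => ∃ U : Set (HeisN n), 0 ∈ U ∧ S ⊆ U ∧ PoincareSet U) ?_ ?_ ?_ ?_
    · obtain ⟨U, h, hU⟩ := exists_poincareSet hn h1
      exact ⟨U, h, Set.empty_subset _, hU⟩
    · exact fun S T hST ⟨U, h, hT, hU⟩ => ⟨U, h, hST.trans hT, hU⟩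
    · exact fun S T ⟨U, h, hS, hU⟩ ⟨U', h', hT, hU'⟩ =>
        ⟨U ∪ U', Or.inl h, Set.union_subset_union hS hT, hU.union hU' ⟨0, h, h'⟩⟩
    · intro x (hx : rhoN x ≤ 1)
      obtain ⟨U, h0, hxU, hU⟩ := exists_poincareSet_zero_mem hn
        (mem_ball_zero.2 (hx.trans_lt one_lt_two))
      exact ⟨U, mem_nhdsWithin_of_mem_nhds (hU.1.mem_nhds hxU), U, h0, subset_rfl, hU⟩
  exact ⟨U, fun x hx => hU (mem_ball_zero.1 hx).le, hP⟩

lemma osc_ball_le (hn : 1 ≤ n) : ∃ M : ENNReal, M ≠ ⊤ ∧ ∀ (p : HeisN n) (r : ℝ), 0 < r →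
    ∀ g : HeisN n → ℝ, ContDiff ℝ 1 g → osc g (KballN p r) (KballN p r)
      ≤ M * ENNReal.ofReal (r ^ (2 * n + 3)) *
        ∫⁻ x in KballN p (2 * r), ENNReal.ofReal (gradbN g x) := by
  obtain ⟨U, hBU, -, -, M, hM, H⟩ := exists_poincareSet_unit_ball hn
  refine ⟨M, hM, fun p r hr g hg => ?_⟩
  set c := ENNReal.ofReal (r ^ (2 * n + 2)) with hc
  have hgc := hg.continuous
  have m1 : Measurable fun x => ∫⁻ y in KballN p r, ‖g x - g y‖ₑ :=
    Measurable.lintegral_prod_right' (f := fun q : HeisN n × HeisN n => ‖g q.1 - g q.2‖ₑ)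
      (Continuous.measurable (by fun_prop))
  have hball : ∀ {F : HeisN n → ENNReal}, Measurable F →
      ∫⁻ x in KballN p r, F x = c * ∫⁻ w in KballN 0 1, F (aff p r w) := fun hF => by
    simpa only [one_mul] using setLIntegral_ball p hr 1 hF
  have hosc : osc g (KballN p r) (KballN p r)
      = c * (c * osc (g ∘ aff p r) (KballN 0 1) (KballN 0 1)) := by
    unfold osc
    have hm : Measurable fun w => ∫⁻ v in KballN 0 1, ‖g (aff p r w) - g (aff p r v)‖ₑ :=
      Measurable.lintegral_prod_right' (f := fun q : HeisN n × HeisN n =>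
        ‖g (aff p r q.1) - g (aff p r q.2)‖ₑ) (Continuous.measurable (by fun_prop))
    simp only [Function.comp_apply]
    rw [hball m1, ← lintegral_const_mul c hm]
    refine congrArg (c * ·) (lintegral_congr fun w => ?_)
    exact hball (F := fun y => ‖g (aff p r w) - g y‖ₑ) (Continuous.measurable (by fun_prop))
  have hgrad : c * gradInt (g ∘ aff p r)
      = ENNReal.ofReal r * ∫⁻ x in KballN p (2 * r), ENNReal.ofReal (gradbN g x) := by
    have hm := (continuous_gradb hg).measurable.ennreal_ofReal
    rw [setLIntegral_ball p hr 2 hm, gradInt]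
    simp only [gradb_comp_aff hg p hr, ENNReal.ofReal_mul hr.le]
    rw [lintegral_const_mul (ENNReal.ofReal r) (f := fun w => ENNReal.ofReal (gradbN g (aff p r w)))
      (hm.comp (continuous_aff p r).measurable)]
    ring
  calc osc g (KballN p r) (KballN p r)
      ≤ c * (c * (M * gradInt (g ∘ aff p r))) := by
        rw [hosc]
        gcongr
        exact (osc_mono hBU hBU).trans (H _ (hg.comp (contDiff_aff p r)))
    _ = c * M * (c * gradInt (g ∘ aff p r)) := by ring
    _ = M * (c * ENNReal.ofReal r) *
        ∫⁻ x in KballN p (2 * r), ENNReal.ofReal (gradbN g x) := by rw [hgrad]; ring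
    _ = _ := by rw [hc, ← ENNReal.ofReal_mul (by positivity), ← pow_succ]

lemma integrableOn_gradb {g : HeisN n → ℝ} (hg : ContDiff ℝ 1 g) (p : HeisN n) {r : ℝ}
    (hr : 0 < r) : IntegrableOn (gradbN g) (KballN p r) := by
  have hK : IsCompact (aff p r '' {x | rhoN x ≤ 1}) :=
    isCompact_rho_le_one.image (continuous_aff p r)
  refine ((continuous_gradb hg).continuousOn.integrableOn_compact hK).mono_set fun x hx => ?_
  have hsurj : aff p r (dil r⁻¹ (HNmul (HNinv p) x)) = x := by
    have hd : ∀ q : HeisN n, dil r (dil r⁻¹ q) = q := fun q => by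
      refine Prod.ext ?_ (Prod.ext ?_ ?_) <;> simp [dil, smul_smul, hr.ne']
    have hi : HNmul p (HNinv p) = 0 := by
      refine Prod.ext ?_ (Prod.ext ?_ ?_) <;> simp [HNmul, HNinv, mul_comm]
    rw [aff, hd, ← HNmul_assoc, hi, zero_HNmul]
  refine ⟨_, ?_, hsurj⟩
  have := aff_preimage_ball p hr 1
  rw [one_mul] at this
  exact (mem_ball_zero.1 (this ▸ (by rwa [Set.mem_preimage, hsurj] :
    dil r⁻¹ (HNmul (HNinv p) x) ∈ aff p r ⁻¹' KballN p r))).le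

lemma volume_ball (p : HeisN n) {r : ℝ} (hr : 0 < r) :
    (volume (KballN p r)).toReal
      = r ^ (2 * n + 2) * (volume (KballN (0 : HeisN n) 1)).toReal := by
  have := setLIntegral_ball p hr 1 (F := fun _ => 1) measurable_const
  rw [setLIntegral_one, setLIntegral_one, one_mul] at this
  rw [this, ENNReal.toReal_mul, ENNReal.toReal_ofReal (by positivity)]

lemma volume_unit_ball_pos : 0 < (volume (KballN (0 : HeisN n) 1)).toReal := by
  refine ENNReal.toReal_pos ((isOpen_ball 0 1).measure_pos volume ⟨0, ?_⟩).ne' ?_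
  · rw [mem_ball_zero, rho_zero]
    exact one_pos
  · exact measure_ne_top_of_subset (fun x hx => (mem_ball_zero.1 hx).le)
      isCompact_rho_le_one.measure_lt_top.ne

end HeisN

/-- the 1-Poincaré inequality on Korányi balls of `ℍⁿ`:
`∫_B∫_B |g(x)−g(y)| ≤ C |B|^{(N+1)/N} ∫_{2B} |∇_b g|`, with `N = 2n+2`. -/
theorem poincare_double_integral :
    ∀ n : ℕ, 1 ≤ n → ∃ C : ℝ,
      ∀ (p : HeisN n) (r : ℝ), 0 < r →
      ∀ g : HeisN n → ℝ, ContDiff ℝ 1 g →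
        (∫ x in KballN p r, ∫ y in KballN p r, |g x - g y|)
          ≤ C * (volume (KballN p r)).toReal ^ ((2 * (n : ℝ) + 3) / (2 * (n : ℝ) + 2)) *
              ∫ x in KballN p (2 * r), gradbN g x := by
  intro n hn
  obtain ⟨M, hM, H⟩ := HeisN.osc_ball_le hn
  set b := (volume (KballN (0 : HeisN n) 1)).toReal with hb
  set e := (2 * (n : ℝ) + 3) / (2 * (n : ℝ) + 2) with he
  have hb0 : 0 < b := HeisN.volume_unit_ball_pos
  refine ⟨M.toReal / b ^ e, fun p r hr g hg => ?_⟩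
  have hgrad0 : ∀ x, 0 ≤ gradbN g x := fun x => Real.sqrt_nonneg _
  have hI0 : 0 ≤ ∫ x in KballN p (2 * r), gradbN g x := integral_nonneg hgrad0
  have hpow : (volume (KballN p r)).toReal ^ e = r ^ (2 * n + 3) * b ^ e := by
    rw [HeisN.volume_ball p hr, Real.mul_rpow (by positivity) hb0.le, ← Real.rpow_natCast,
      ← Real.rpow_mul hr.le, ← Real.rpow_natCast r (2 * n + 3)]
    congr 2
    rw [he]
    push_cast
    field_simp
  have hle : ENNReal.ofReal (∫ x in KballN p r, ∫ y in KballN p r, |g x - g y|)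
      ≤ HeisN.osc g (KballN p r) (KballN p r) := by
    refine (Real.ofReal_le_enorm _).trans ((enorm_integral_le_lintegral_enorm _).trans
      (lintegral_mono fun x => (enorm_integral_le_lintegral_enorm _).trans
        (lintegral_mono fun y => ?_)))
    rw [← Real.norm_eq_abs, enorm_norm]
  have hfin := hle.trans (H p r hr g hg)
  rw [← ofReal_integral_eq_lintegral_ofReal (HeisN.integrableOn_gradb hg p (by positivity))
    (Filter.Eventually.of_forall hgrad0), ← ENNReal.ofReal_toReal hM,
    ← ENNReal.ofReal_mul (by positivity), ← ENNReal.ofReal_mul (by positivity),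
    ENNReal.ofReal_le_ofReal_iff (by positivity)] at hfin
  rw [hpow]
  have : M.toReal / b ^ e * (r ^ (2 * n + 3) * b ^ e) = M.toReal * r ^ (2 * n + 3) := by
    field_simp
  rwa [this]

end
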